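/- arXiv:1510.02864 — 2 statements merged into one kernel-verified Lean document; each statement's English description precedes it below -/
import Mathlib

section
/- Assume ρ ∈ (0,1) and σx = σy. Then (a*, b*) is a global pure equilibrium: K(a*, b) ≤ 0 ≤ K(a, b*) for all a, b ∈ ℝ². -/
open MeasureTheory ProbabilityTheory Real

/-- The bivariate normal measure on ℝ × ℝ with mean (0,0), standard deviations
`sx, sy` and correlation `ρ`, realized as the pushforward of two independent
standard gaussians. -/
noncomputable def binormal (sx sy ρ : ℝ) : Measure (ℝ × ℝ) :=
  Measure.map (fun z : ℝ × ℝ => (sx * z.1, sy * (ρ * z.1 + Real.sqrt (1 - ρ ^ 2) * z.2)))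
    ((gaussianReal 0 1).prod (gaussianReal 0 1))

/-- The set of points strictly closer (in Euclidean distance) to `a` than to `b`. -/
def closerTo (a b : ℝ × ℝ) : Set (ℝ × ℝ) :=
  {p | (p.1 - a.1) ^ 2 + (p.2 - a.2) ^ 2 < (p.1 - b.1) ^ 2 + (p.2 - b.2) ^ 2}

/-- The expected payoff (from Player I to Player II) when Player I offers `a`
and Player II offers `b`. -/
noncomputable def K (sx sy ρ : ℝ) (a b : ℝ × ℝ) : ℝ :=
  if a = b then a.1 + a.2
  else (a.1 + a.2) * ((binormal sx sy ρ) (closerTo a b)).toReal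
    + (b.1 + b.2) * ((binormal sx sy ρ) (closerTo b a)).toReal

/-- The common optimal offer magnitude. -/
noncomputable def cstar (sx sy ρ : ℝ) : ℝ :=
  Real.sqrt (2 * Real.pi * (sx ^ 2 + 2 * ρ * sx * sy + sy ^ 2)) / 4

/-- The standard normal cdf is differentiable, with derivative the standard normal density. -/
lemma hasDerivAt_cdf_gaussianReal (x : ℝ) :
    HasDerivAt (cdf (gaussianReal 0 1)) (gaussianPDFReal 0 1 x) x := by
  have hint := integrable_gaussianPDFReal 0 1
  have hcont : Continuous (gaussianPDFReal 0 1) := by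
    unfold gaussianPDFReal; fun_prop
  have hcdf (y : ℝ) : cdf (gaussianReal 0 1) y = ∫ t in Set.Iic y, gaussianPDFReal 0 1 t := by
    rw [cdf_eq_real, Measure.real, gaussianReal_apply_eq_integral 0 one_ne_zero,
      ENNReal.toReal_ofReal (integral_nonneg fun t => gaussianPDFReal_nonneg 0 1 t)]
  have heq : ⇑(cdf (gaussianReal 0 1)) =
      fun y => (∫ t in (0 : ℝ)..y, gaussianPDFReal 0 1 t) + cdf (gaussianReal 0 1) 0 := by
    funext y
    rw [← intervalIntegral.integral_Iic_sub_Iic hint.integrableOn hint.integrableOn,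
      ← hcdf, ← hcdf]
    ring
  rw [heq]
  exact (intervalIntegral.integral_hasDerivAt_right (hcont.intervalIntegrable _ _)
    (hcont.stronglyMeasurableAtFilter _ _) hcont.continuousAt).add_const _

lemma cdf_gaussianReal_eq_real_Iio (x : ℝ) :
    cdf (gaussianReal 0 1) x = (gaussianReal 0 1).real (Set.Iio x) := by
  have := nullSingletonClass_gaussianReal (μ := 0) (v := 1) one_ne_zero
  rw [cdf_eq_real, measureReal_congr Iio_ae_eq_Iic]

lemma cdf_gaussianReal_neg (x : ℝ) :
    cdf (gaussianReal 0 1) (-x) = 1 - cdf (gaussianReal 0 1) x := by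
  have hneg : (gaussianReal 0 1).map (fun y : ℝ => -y) = gaussianReal 0 1 := by
    simpa using gaussianReal_map_neg (μ := 0) (v := 1)
  have hset : (fun y : ℝ => -y) ⁻¹' Set.Iio (-x) = (Set.Iic x)ᶜ := by
    ext y; simp
  rw [cdf_gaussianReal_eq_real_Iio, cdf_eq_real]
  conv_lhs => rw [← hneg]
  rw [map_measureReal_apply measurable_neg measurableSet_Iio, hset,
    probReal_compl_eq_one_sub measurableSet_Iic]

lemma cdf_gaussianReal_zero : cdf (gaussianReal 0 1) 0 = 1 / 2 := by
  have := cdf_gaussianReal_neg 0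
  rw [neg_zero] at this
  linarith

/-- The law of a unit-norm linear combination of two independent standard normals. -/
lemma map_linear_prod_gaussianReal {α β : ℝ} (h : α ^ 2 + β ^ 2 = 1) :
    ((gaussianReal 0 1).prod (gaussianReal 0 1)).map (fun z : ℝ × ℝ => α * z.1 + β * z.2) =
      gaussianReal 0 1 := by
  have hind := indepFun_prod (μ := gaussianReal 0 1) (ν := gaussianReal 0 1)
    (measurable_const_mul α) (measurable_const_mul β)
  have h1 : ((gaussianReal 0 1).prod (gaussianReal 0 1)).map (fun z : ℝ × ℝ => α * z.1) =
      gaussianReal (α * 0) (.mk (α ^ 2) (sq_nonneg _) * 1) := by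
    rw [← gaussianReal_map_const_mul α]
    conv_rhs =>
      rw [← (measurePreserving_fst (μ := gaussianReal 0 1) (ν := gaussianReal 0 1)).map_eq,
        Measure.map_map (by fun_prop) measurable_fst]
    rfl
  have h2 : ((gaussianReal 0 1).prod (gaussianReal 0 1)).map (fun z : ℝ × ℝ => β * z.2) =
      gaussianReal (β * 0) (.mk (β ^ 2) (sq_nonneg _) * 1) := by
    rw [← gaussianReal_map_const_mul β]
    conv_rhs =>
      rw [← (measurePreserving_snd (μ := gaussianReal 0 1) (ν := gaussianReal 0 1)).map_eq,
        Measure.map_map (by fun_prop) measurable_snd]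
    rfl
  have := gaussianReal_add_gaussianReal_of_indepFun hind h1 h2
  convert! this using 2
  · simp
  · ext; simp [h]

lemma prod_gaussianReal_real_linear_lt {α β : ℝ} (h : 0 < α ^ 2 + β ^ 2) (m : ℝ) :
    ((gaussianReal 0 1).prod (gaussianReal 0 1)).real {z : ℝ × ℝ | α * z.1 + β * z.2 < m} =
      cdf (gaussianReal 0 1) (m / √(α ^ 2 + β ^ 2)) := by
  set r := √(α ^ 2 + β ^ 2) with hr
  have hr0 : 0 < r := Real.sqrt_pos.2 h
  have hr2 : r ^ 2 = α ^ 2 + β ^ 2 := Real.sq_sqrt h.le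
  have hunit : (α / r) ^ 2 + (β / r) ^ 2 = 1 := by
    rw [div_pow, div_pow, ← add_div, ← hr2, div_self (pow_pos hr0 2).ne']
  rw [cdf_gaussianReal_eq_real_Iio]
  conv_rhs => rw [← map_linear_prod_gaussianReal hunit]
  rw [map_measureReal_apply (by fun_prop) measurableSet_Iio]
  refine congrArg _ (Set.ext fun z => ?_)
  have : α / r * z.1 + β / r * z.2 = (α * z.1 + β * z.2) / r := by ring
  simp only [Set.mem_ofPred_eq, Set.mem_preimage, Set.mem_Iio, this, div_lt_div_iff_of_pos_right hr0]

lemma binormal_closerTo {s ρ : ℝ} (hs : 0 < s) (hρ : ρ ∈ Set.Ioo (0 : ℝ) 1) {a b : ℝ × ℝ}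
    (hab : a ≠ b) :
    ((binormal s s ρ) (closerTo a b)).toReal = cdf (gaussianReal 0 1)
      (((b.1 ^ 2 + b.2 ^ 2 - a.1 ^ 2 - a.2 ^ 2) / 2) /
        √(s ^ 2 * ((b.1 - a.1) ^ 2 + 2 * ρ * (b.1 - a.1) * (b.2 - a.2) + (b.2 - a.2) ^ 2))) := by
  obtain ⟨h0, h1⟩ := hρ
  have hmeas : MeasurableSet (closerTo a b) := by
    unfold closerTo
    exact measurableSet_lt (by fun_prop) (by fun_prop)
  have hq : √(1 - ρ ^ 2) ^ 2 = 1 - ρ ^ 2 := Real.sq_sqrt (by nlinarith)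
  have hV : s ^ 2 * ((b.1 - a.1) ^ 2 + 2 * ρ * (b.1 - a.1) * (b.2 - a.2) + (b.2 - a.2) ^ 2) =
      (s * ((b.1 - a.1) + ρ * (b.2 - a.2))) ^ 2 + (s * √(1 - ρ ^ 2) * (b.2 - a.2)) ^ 2 := by
    rw [mul_pow (s * _), mul_pow s √_, hq]; ring
  have hpos : 0 < s ^ 2 *
      ((b.1 - a.1) ^ 2 + 2 * ρ * (b.1 - a.1) * (b.2 - a.2) + (b.2 - a.2) ^ 2) := by
    apply mul_pos (pow_pos hs 2)
    have hne : b.1 - a.1 ≠ 0 ∨ b.2 - a.2 ≠ 0 := by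
      by_contra! h
      exact hab (Prod.ext (sub_eq_zero.1 h.1).symm (sub_eq_zero.1 h.2).symm)
    have hsq : 0 < (b.1 - a.1) ^ 2 + (b.2 - a.2) ^ 2 := by
      rcases hne with h | h <;> positivity
    nlinarith [mul_nonneg h0.le (sq_nonneg (b.1 - a.1 + (b.2 - a.2)))]
  rw [hV] at hpos ⊢
  rw [← prod_gaussianReal_real_linear_lt hpos, binormal,
    Measure.map_apply (by fun_prop) hmeas, Measure.real]
  congr 2
  ext z
  simp only [closerTo, Set.mem_preimage, Set.mem_ofPred_eq]
  constructor <;> intro h <;> linarith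

/-- An algebraic lower bound for the standard normal cdf, tangent to it at `0`. -/
lemma one_sub_inv_le_cdf_gaussianReal {k z : ℝ} (hk : k = 2 / √(2 * π)) (hz : 0 < 1 + k * z) :
    1 - 1 / (2 * (1 + k * z)) ≤ cdf (gaussianReal 0 1) z := by
  have hr : 0 < √(2 * π) := by positivity
  have hk0 : 0 < k := by rw [hk]; positivity
  let H : ℝ → ℝ := fun y => cdf (gaussianReal 0 1) y - (1 - 1 / (2 * (1 + k * y)))
  let H' : ℝ → ℝ := fun y => k / 2 * (Real.exp (-y ^ 2 / 2) - 1 / (1 + k * y) ^ 2)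
  have hH (y : ℝ) (hy : 0 < 1 + k * y) : HasDerivAt H (H' y) y := by
    have hlin : HasDerivAt (fun y : ℝ => 2 * (1 + k * y)) (2 * (k * 1)) y :=
      (((hasDerivAt_id y).const_mul k).const_add 1).const_mul 2
    have := (hasDerivAt_cdf_gaussianReal y).sub
      (((hasDerivAt_const y (1 : ℝ)).div hlin (by positivity)).const_sub 1)
    convert! this using 1
    have hpdf : gaussianPDFReal 0 1 y = k / 2 * Real.exp (-y ^ 2 / 2) := by
      simp only [gaussianPDFReal, hk, NNReal.coe_one, mul_one, sub_zero]
      field_simp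
    simp only [H', hpdf]
    field_simp
    ring
  have hcont (D : Set ℝ) (hD : ∀ y ∈ D, 0 < 1 + k * y) : ContinuousOn H D :=
    fun y hy => (hH y (hD y hy)).continuousAt.continuousWithinAt
  have hH0 : H 0 = 0 := by
    simp only [H, cdf_gaussianReal_zero]; norm_num
  have hexp (y : ℝ) : Real.exp (-y ^ 2 / 2) = 1 / Real.exp (y ^ 2 / 4) ^ 2 := by
    rw [one_div, ← Real.exp_nat_mul, ← Real.exp_neg]; congr 1; push_cast; ring
  have hpos (y : ℝ) (hy : 0 < 1 + k * y) (h : Real.exp (y ^ 2 / 4) ≤ 1 + k * y) : 0 ≤ H' y := by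
    refine mul_nonneg (by positivity) (sub_nonneg.2 ?_)
    rw [hexp]; gcongr
  have hneg (y : ℝ) (hy : 0 < 1 + k * y) (h : 1 + k * y ≤ Real.exp (y ^ 2 / 4)) : H' y ≤ 0 := by
    refine mul_nonpos_of_nonneg_of_nonpos (by positivity) (sub_nonpos.2 ?_)
    rw [hexp]; gcongr
  -- on the positive axis, `exp (y ^ 2 / 4) ≤ 1 + k * y` is inherited by smaller arguments
  have hinherit {x y : ℝ} (hx : 0 ≤ x) (hxy : x ≤ y)
      (h : Real.exp (y ^ 2 / 4) ≤ 1 + k * y) : Real.exp (x ^ 2 / 4) ≤ 1 + k * x := by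
    rcases hx.eq_or_lt with rfl | hx
    · simp
    have hy : 0 < y := hx.trans_le hxy
    have hconv := convexOn_exp.2 (Set.mem_univ 0) (Set.mem_univ (y ^ 2 / 4))
      (sub_nonneg.2 ((div_le_one hy).2 hxy)) (div_pos hx hy).le (sub_add_cancel 1 (x / y))
    simp only [smul_eq_mul, mul_zero, zero_add, Real.exp_zero, mul_one] at hconv
    have hle : x ^ 2 / 4 ≤ x / y * (y ^ 2 / 4) := by
      rw [show x / y * (y ^ 2 / 4) = x * y / 4 by field_simp]
      nlinarith
    calc Real.exp (x ^ 2 / 4) ≤ 1 - x / y + x / y * Real.exp (y ^ 2 / 4) :=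
          (Real.exp_le_exp.2 hle).trans hconv
      _ ≤ 1 - x / y + x / y * (1 + k * y) := by gcongr
      _ = 1 + k * x := by field_simp; ring
  suffices 0 ≤ H z by simpa [H] using this
  rcases le_total z 0 with hz0 | hz0
  · have hD (y : ℝ) (hy : y ∈ Set.Icc z 0) : 0 < 1 + k * y := by nlinarith [hy.1]
    have hanti : AntitoneOn H (Set.Icc z 0) :=
      antitoneOn_of_hasDerivWithinAt_nonpos (convex_Icc z 0) (hcont _ hD)
        (fun y hy => (hH y (hD y (interior_subset hy))).hasDerivWithinAt)
        (fun y hy => hneg y (hD y (interior_subset hy)) (by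
          have h1 : y ≤ 0 := (interior_subset hy).2
          have h2 := Real.one_le_exp (x := y ^ 2 / 4) (by positivity)
          nlinarith))
    rw [← hH0]
    exact hanti (Set.left_mem_Icc.2 hz0) (Set.right_mem_Icc.2 hz0) hz0
  rcases le_or_gt (Real.exp (z ^ 2 / 4)) (1 + k * z) with hle | hle
  · have hD (y : ℝ) (hy : y ∈ Set.Icc 0 z) : 0 < 1 + k * y := by nlinarith [hy.1]
    have hmono : MonotoneOn H (Set.Icc 0 z) :=
      monotoneOn_of_hasDerivWithinAt_nonneg (convex_Icc 0 z) (hcont _ hD)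
        (fun y hy => (hH y (hD y (interior_subset hy))).hasDerivWithinAt)
        (fun y hy => hpos y (hD y (interior_subset hy))
          (hinherit (interior_subset hy).1 (interior_subset hy).2 hle))
    rw [← hH0]
    exact hmono (Set.left_mem_Icc.2 hz0) (Set.right_mem_Icc.2 hz0) hz0
  · have hD (y : ℝ) (hy : y ∈ Set.Ici z) : 0 < 1 + k * y := by
      nlinarith [Set.mem_Ici.1 hy]
    have hanti : AntitoneOn H (Set.Ici z) :=
      antitoneOn_of_hasDerivWithinAt_nonpos (convex_Ici z) (hcont _ hD)
        (fun y hy => (hH y (hD y (interior_subset hy))).hasDerivWithinAt)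
        (fun y hy => hneg y (hD y (interior_subset hy)) (by
          by_contra! hlt
          have hy' : z < y := by simpa using hy
          exact absurd (hinherit hz0 hy'.le hlt.le) hle.not_ge))
    have hlim : Filter.Tendsto H Filter.atTop (nhds 0) := by
      have h1 : Filter.Tendsto (fun y : ℝ => 1 / (2 * (1 + k * y))) Filter.atTop (nhds 0) := by
        refine Filter.Tendsto.const_div_atTop ?_ 1
        exact (Filter.tendsto_atTop_add_const_left _ 1
          (Filter.tendsto_id.const_mul_atTop hk0)).const_mul_atTop two_pos
      simpa [H] using (tendsto_cdf_atTop (gaussianReal 0 1)).sub (h1.const_sub 1)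
    refine le_of_tendsto hlim ?_
    filter_upwards [Filter.eventually_ge_atTop z] with y hy
    exact hanti Set.self_mem_Ici hy hy

lemma cstar_nonneg (sx sy ρ : ℝ) : 0 ≤ cstar sx sy ρ := by
  unfold cstar; positivity

/-- Reflecting both offers through the origin flips the sign of the payoff. -/
lemma K_neg_neg {s ρ : ℝ} (hs : 0 < s) (hρ : ρ ∈ Set.Ioo (0 : ℝ) 1) (a b : ℝ × ℝ) :
    K s s ρ (-b) (-a) = -K s s ρ a b := by
  by_cases hab : a = b
  · simp [K, hab]; ring
  · have hba : -b ≠ -a := fun h => hab (neg_injective h).symm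
    rw [K, K, if_neg hab, if_neg hba, binormal_closerTo hs hρ hab,
      binormal_closerTo hs hρ (Ne.symm hab), binormal_closerTo hs hρ hba,
      binormal_closerTo hs hρ (Ne.symm hba)]
    simp only [Prod.fst_neg, Prod.snd_neg]
    ring_nf

lemma K_cstar_le_zero {s ρ : ℝ} (hs : 0 < s) (hρ : ρ ∈ Set.Ioo (0 : ℝ) 1) (b : ℝ × ℝ) :
    K s s ρ (-cstar s s ρ, -cstar s s ρ) b ≤ 0 := by
  set c := cstar s s ρ with hc
  have hc0 : 0 ≤ c := cstar_nonneg s s ρ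
  by_cases hab : (-c, -c) = b
  · rw [K, if_pos hab]; simp only; linarith
  rw [K, if_neg hab]
  rcases le_or_gt (b.1 + b.2) 0 with hS | hS
  · exact add_nonpos
      (mul_nonpos_of_nonpos_of_nonneg (by simp only; linarith) ENNReal.toReal_nonneg)
      (mul_nonpos_of_nonpos_of_nonneg hS ENNReal.toReal_nonneg)
  rw [binormal_closerTo hs hρ hab, binormal_closerTo hs hρ (Ne.symm hab)]
  obtain ⟨h0, h1⟩ := hρ
  obtain ⟨u, v⟩ := b
  simp only at hS ⊢
  set V := s ^ 2 * ((u - -c) ^ 2 + 2 * ρ * (u - -c) * (v - -c) + (v - -c) ^ 2) with hV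
  rw [show s ^ 2 * ((-c - u) ^ 2 + 2 * ρ * (-c - u) * (-c - v) + (-c - v) ^ 2) = V by
    rw [hV]; ring]
  set m := (u ^ 2 + v ^ 2 - (-c) ^ 2 - (-c) ^ 2) / 2 with hm
  rw [show ((-c) ^ 2 + (-c) ^ 2 - u ^ 2 - v ^ 2) / 2 / √V = -(m / √V) by rw [hm]; ring,
    cdf_gaussianReal_neg]
  set τ := s * √((1 + ρ) / 2) with hτ
  have hτ0 : 0 < τ := by positivity
  have hτ2 : τ ^ 2 = s ^ 2 * ((1 + ρ) / 2) := by
    rw [hτ, mul_pow, Real.sq_sqrt (by positivity)]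
  have hcτ : 2 * c = τ * √(2 * π) := by
    have : 2 * π * (s ^ 2 + 2 * ρ * s * s + s ^ 2) = (2 * τ) ^ 2 * (2 * π) := by
      rw [mul_pow, hτ2]; ring
    rw [hc, cstar, this, Real.sqrt_mul (by positivity), Real.sqrt_sq (by positivity)]
    ring
  have hcpos : 0 < c := by
    have : 0 < τ * √(2 * π) := by positivity
    linarith
  have hVpos : 0 < V := by
    have : V = τ ^ 2 * (u + v + 2 * c) ^ 2 + s ^ 2 * ((1 - ρ) / 2) * (u - v) ^ 2 := by
      rw [hV, hτ2]; ring
    rw [this]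
    have : 0 < 1 - ρ := by linarith
    positivity
  set z := (u + v - 2 * c) / (4 * τ) with hz
  have hzle : z ≤ m / √V := by
    rw [le_div_iff₀ (Real.sqrt_pos.2 hVpos), hz, div_mul_eq_mul_div, div_le_iff₀ (by positivity)]
    have hVeq : V = (τ * (u + v + 2 * c)) ^ 2 + s ^ 2 * ((1 - ρ) / 2) * (u - v) ^ 2 := by
      rw [mul_pow, hV, hτ2]; ring
    have hmeq : m * (4 * τ) = τ * ((u + v - 2 * c) * (u + v + 2 * c) + (u - v) ^ 2) := by
      rw [hm]; ring
    have hD : 0 ≤ s ^ 2 * ((1 - ρ) / 2) * (u - v) ^ 2 := by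
      have : 0 < 1 - ρ := by linarith
      positivity
    have ht : 0 < τ * (u + v + 2 * c) := by positivity
    rw [hmeq]
    rcases le_total (u + v - 2 * c) 0 with hS' | hS'
    · have : τ * (u + v + 2 * c) ≤ √V := Real.le_sqrt_of_sq_le (by linarith)
      nlinarith [mul_le_mul_of_nonpos_left this hS', mul_nonneg hτ0.le (sq_nonneg (u - v))]
    · have hsqrt : √V ≤ τ * (u + v + 2 * c) +
          s ^ 2 * ((1 - ρ) / 2) * (u - v) ^ 2 / (2 * (τ * (u + v + 2 * c))) := by
        rw [hVeq]
        refine Real.sqrt_le_iff.2 ⟨by positivity, ?_⟩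
        generalize s ^ 2 * ((1 - ρ) / 2) * (u - v) ^ 2 = D at hD
        generalize τ * (u + v + 2 * c) = T at ht
        have : (T + D / (2 * T)) ^ 2 = T ^ 2 + D + (D / (2 * T)) ^ 2 := by field_simp; ring
        rw [this]
        linarith [sq_nonneg (D / (2 * T))]
      have hcorr : (u + v - 2 * c) *
          (s ^ 2 * ((1 - ρ) / 2) * (u - v) ^ 2 / (2 * (τ * (u + v + 2 * c)))) ≤
          τ * (u - v) ^ 2 := by
        rw [← mul_div_assoc, div_le_iff₀ (by positivity)]
        have hkey : (u + v - 2 * c) * ((1 - ρ) / 2) ≤ (u + v + 2 * c) * (1 + ρ) := by nlinarith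
        have := mul_le_mul_of_nonneg_left hkey
          (mul_nonneg (sq_nonneg s) (sq_nonneg (u - v)))
        calc _ = s ^ 2 * (u - v) ^ 2 * ((u + v - 2 * c) * ((1 - ρ) / 2)) := by ring
          _ ≤ s ^ 2 * (u - v) ^ 2 * ((u + v + 2 * c) * (1 + ρ)) := this
          _ = 2 * τ ^ 2 * (u - v) ^ 2 * (u + v + 2 * c) := by rw [hτ2]; ring
          _ = _ := by ring
      nlinarith [mul_le_mul_of_nonneg_left hsqrt hS']
  have hkz : 1 + 2 / √(2 * π) * z = (u + v + 2 * c) / (4 * c) := by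
    have hr : √(2 * π) = 2 * c / τ := by rw [hcτ]; field_simp
    rw [hr, hz]; field_simp; ring
  have hbound : 1 - 2 * c / (u + v + 2 * c) ≤ cdf (gaussianReal 0 1) (m / √V) := by
    refine le_trans (le_of_eq ?_) ((one_sub_inv_le_cdf_gaussianReal rfl
      (by rw [hkz]; positivity)).trans (monotone_cdf _ hzle))
    rw [hkz]; field_simp; ring
  rw [sub_le_iff_le_add, ← sub_le_iff_le_add', le_div_iff₀ (by positivity)] at hbound
  nlinarith

theorem global_equilibrium_equal_sigmas (sx sy ρ : ℝ) (hsx : 0 < sx) (hsy : 0 < sy)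
    (hρ : ρ ∈ Set.Ioo (0 : ℝ) 1) (hσ : sx = sy) :
    let c := cstar sx sy ρ
    ∀ a b : ℝ × ℝ, K sx sy ρ ((-c, -c) : ℝ × ℝ) b ≤ 0 ∧
      0 ≤ K sx sy ρ a ((c, c) : ℝ × ℝ) := by
  subst hσ
  intro c a b
  refine ⟨K_cstar_le_zero hsx hρ b, ?_⟩
  have h := K_cstar_le_zero hsx hρ (-a)
  have hneg := K_neg_neg hsx hρ a (c, c)
  rw [Prod.neg_mk] at hneg
  linarith
end

section
/- Assume ρ ∈ (0,1). Let a = (x1, y1) ∈ ℝ² with a ≠ a*. If K(a, b*) ≤ 0, then x1 + y1 < 0, and moreover either x1² + y1² < 2c² or x1 + y1 ≤ −2c. -/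
open MeasureTheory ProbabilityTheory Real

theorem continuous_binormal_transform (sx sy ρ : ℝ) :
    Continuous (fun z : ℝ × ℝ => (sx * z.1, sy * (ρ * z.1 + Real.sqrt (1 - ρ ^ 2) * z.2))) := by
  fun_prop

instance isProbabilityMeasure_binormal (sx sy ρ : ℝ) :
    IsProbabilityMeasure (binormal sx sy ρ) :=
  Measure.isProbabilityMeasure_map (continuous_binormal_transform sx sy ρ).aemeasurable

theorem isOpenPosMeasure_gaussianReal (μ : ℝ) {v : NNReal} (hv : v ≠ 0) :
    (gaussianReal μ v).IsOpenPosMeasure :=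
  (gaussianReal_absolutelyContinuous' μ hv).isOpenPosMeasure

theorem isOpenPosMeasure_binormal {sx sy ρ : ℝ} (hsx : sx ≠ 0) (hsy : sy ≠ 0)
    (hρ : |ρ| < 1) : (binormal sx sy ρ).IsOpenPosMeasure := by
  have := isOpenPosMeasure_gaussianReal 0 one_ne_zero
  have hr : Real.sqrt (1 - ρ ^ 2) ≠ 0 :=
    (Real.sqrt_pos.2 (sub_pos.2 ((sq_lt_one_iff_abs_lt_one ρ).2 hρ))).ne'
  refine (continuous_binormal_transform sx sy ρ).isOpenPosMeasure_map fun p => ?_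
  refine ⟨(p.1 / sx, (p.2 / sy - ρ * (p.1 / sx)) / Real.sqrt (1 - ρ ^ 2)), ?_⟩
  ext
  · simp only
    field_simp
  · simp only
    rw [mul_div_cancel₀ _ hr, add_sub_cancel, mul_div_cancel₀ _ hsy]

theorem binormal_map_neg (sx sy ρ : ℝ) :
    (binormal sx sy ρ).map (fun p => -p) = binormal sx sy ρ := by
  have h : ((gaussianReal 0 1).prod (gaussianReal 0 1)).map (Prod.map (fun x => -x) (fun x => -x)) =
      (gaussianReal 0 1).prod (gaussianReal 0 1) := by
    rw [← Measure.map_prod_map _ _ measurable_neg measurable_neg, gaussianReal_map_neg, neg_zero]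
  have hT := (continuous_binormal_transform sx sy ρ).measurable
  unfold binormal
  conv_rhs => rw [← h, Measure.map_map hT (by fun_prop)]
  rw [Measure.map_map measurable_neg hT]
  congr 1
  ext z <;> simp
  ring

theorem isOpen_closerTo (a b : ℝ × ℝ) : IsOpen (closerTo a b) :=
  isOpen_lt (by fun_prop) (by fun_prop)

theorem closerTo_nonempty {a b : ℝ × ℝ} (hab : a ≠ b) : (closerTo a b).Nonempty := by
  refine ⟨a, ?_⟩
  have h : a.1 - b.1 ≠ 0 ∨ a.2 - b.2 ≠ 0 := by
    simp only [sub_ne_zero]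
    contrapose! hab
    exact Prod.ext hab.1 hab.2
  simp only [closerTo, Set.mem_ofPred_eq, sub_self, zero_pow two_ne_zero, add_zero]
  rcases h with h | h <;> positivity

/-- The offer farther from the mean is chosen with probability at most one half. -/
theorem binormal_closerTo_le (sx sy ρ : ℝ) {a b : ℝ × ℝ}
    (hab : b.1 ^ 2 + b.2 ^ 2 ≤ a.1 ^ 2 + a.2 ^ 2) :
    binormal sx sy ρ (closerTo a b) ≤ binormal sx sy ρ (closerTo b a) := by
  conv_rhs => rw [← binormal_map_neg,
    Measure.map_apply measurable_neg (isOpen_closerTo b a).measurableSet]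
  refine measure_mono fun p hp => ?_
  simp only [closerTo, Set.mem_ofPred_eq, Set.mem_preimage, Prod.fst_neg, Prod.snd_neg] at hp ⊢
  nlinarith

theorem binormal_closerTo_toReal_pos {sx sy ρ : ℝ} (hsx : sx ≠ 0) (hsy : sy ≠ 0)
    (hρ : |ρ| < 1) {a b : ℝ × ℝ} (hab : a ≠ b) :
    0 < (binormal sx sy ρ (closerTo a b)).toReal := by
  have := isOpenPosMeasure_binormal hsx hsy hρ
  exact ENNReal.toReal_pos ((isOpen_closerTo a b).measure_ne_zero _ (closerTo_nonempty hab))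
    (measure_ne_top _ _)

theorem cstar_pos {sx sy ρ : ℝ} (hsx : 0 < sx) (hsy : 0 < sy) (hρ : 0 < ρ) :
    0 < cstar sx sy ρ := by
  unfold cstar
  positivity

theorem nonpositive_payoff_region (sx sy ρ : ℝ) (hsx : 0 < sx) (hsy : 0 < sy)
    (hρ : ρ ∈ Set.Ioo (0 : ℝ) 1) (a : ℝ × ℝ)
    (ha : a ≠ ((-cstar sx sy ρ, -cstar sx sy ρ) : ℝ × ℝ))
    (hK : K sx sy ρ a ((cstar sx sy ρ, cstar sx sy ρ) : ℝ × ℝ) ≤ 0) :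
    a.1 + a.2 < 0 ∧
      (a.1 ^ 2 + a.2 ^ 2 < 2 * (cstar sx sy ρ) ^ 2 ∨
        a.1 + a.2 ≤ -(2 * cstar sx sy ρ)) := by
  have hc := cstar_pos hsx hsy hρ.1
  set c := cstar sx sy ρ
  have hρ' : |ρ| < 1 := abs_lt.2 ⟨by linarith [hρ.1], hρ.2⟩
  have hab : a ≠ (c, c) := by
    rintro rfl
    simp only [K, if_pos] at hK
    linarith
  have hP := binormal_closerTo_toReal_pos hsx.ne' hsy.ne' hρ' hab
  have hQ := binormal_closerTo_toReal_pos hsx.ne' hsy.ne' hρ' hab.symm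
  rw [K, if_neg hab] at hK
  refine ⟨?_, ?_⟩
  · by_contra! hs
    nlinarith [mul_nonneg hs hP.le, mul_pos hc hQ]
  · by_contra! h
    have hPQ := ENNReal.toReal_mono (measure_ne_top _ _)
      (binormal_closerTo_le sx sy ρ (a := a) (b := (c, c)) (by linarith [h.1]))
    nlinarith [mul_pos (neg_lt_iff_pos_add.1 h.2) hP, mul_nonneg hc.le (sub_nonneg.2 hPQ)]
end
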